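/- Virial identity: if A is a geodesic of SL(n) with the Hilbert–Schmidt metric, then the function t ↦ ‖A(t)‖² is twice differentiable and satisfies, for all t ∈ ℝ, (d²/dt²)‖A(t)‖² = 2‖A'(t)‖² + 2n · tr(A'(t)·A(t)⁻¹·A'(t)·A(t)⁻¹) / tr(A(t)⁻¹·(A(t)⁻¹)ᵀ). -/

import Mathlib

noncomputable section
open Matrix Filter

attribute [local instance] Matrix.normedAddCommGroup Matrix.normedSpace

/-- The Hilbert–Schmidt norm of a square real matrix. -/
def hsNorm {n : ℕ} (X : Matrix (Fin n) (Fin n) ℝ) : ℝ :=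
  Real.sqrt (Matrix.trace (X * Xᵀ))

/-- A geodesic of `SL(n)` with the Hilbert–Schmidt metric. -/
def IsGeodesic {n : ℕ} (A : ℝ → Matrix (Fin n) (Fin n) ℝ) : Prop :=
  (∀ t, DifferentiableAt ℝ A t) ∧ (∀ t, DifferentiableAt ℝ (deriv A) t) ∧
  (∀ t, (A t).det = 1) ∧
  (∀ t, deriv (deriv A) t =
    (Matrix.trace (deriv A t * (A t)⁻¹ * deriv A t * (A t)⁻¹) /
      Matrix.trace ((A t)⁻¹ * ((A t)⁻¹)ᵀ)) • ((A t)⁻¹)ᵀ)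

theorem hsNorm_sq {n : ℕ} (X : Matrix (Fin n) (Fin n) ℝ) :
    hsNorm X ^ 2 = Matrix.trace (X * Xᵀ) :=
  Real.sq_sqrt <| by
    simpa using (Matrix.posSemidef_self_mul_conjTranspose X).trace_nonneg

theorem HasDerivAt.trace_mul_transpose {n : ℕ} {X Y : ℝ → Matrix (Fin n) (Fin n) ℝ}
    {X' Y' : Matrix (Fin n) (Fin n) ℝ} {t : ℝ} (hX : HasDerivAt X X' t)
    (hY : HasDerivAt Y Y' t) :
    HasDerivAt (fun s => Matrix.trace (X s * (Y s)ᵀ))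
      (Matrix.trace (X' * (Y t)ᵀ) + Matrix.trace (X t * Y'ᵀ)) t := by
  have entry {Z : ℝ → Matrix (Fin n) (Fin n) ℝ} {Z' : Matrix (Fin n) (Fin n) ℝ}
      (hZ : HasDerivAt Z Z' t) (i j : Fin n) : HasDerivAt (fun s => Z s i j) (Z' i j) t :=
    hasDerivAt_pi.1 (hasDerivAt_pi.1 hZ i) j
  simp only [Matrix.trace, Matrix.diag_apply, Matrix.mul_apply, Matrix.transpose_apply,
    ← Finset.sum_add_distrib]
  exact HasDerivAt.fun_sum fun i _ => HasDerivAt.fun_sum fun j _ =>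
    (entry hX i j).mul (entry hY i j)

theorem trace_mul_transpose_comm {n : ℕ} (X Y : Matrix (Fin n) (Fin n) ℝ) :
    Matrix.trace (X * Yᵀ) = Matrix.trace (Y * Xᵀ) := by
  rw [← Matrix.trace_transpose, Matrix.transpose_mul, Matrix.transpose_transpose]

/-- the Virial identity. Along a geodesic `A` of `SL(n)` with the
Hilbert–Schmidt metric, `t ↦ ‖A(t)‖²` is twice differentiable with
`(‖A‖²)'' = 2‖A'‖² + 2n·tr(A'A⁻¹A'A⁻¹)/tr(A⁻¹A⁻ᵀ)`. -/
theorem statement_7 {n : ℕ} (A : ℝ → Matrix (Fin n) (Fin n) ℝ) (hA : IsGeodesic A) :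
    (∀ t, DifferentiableAt ℝ (fun s => hsNorm (A s) ^ 2) t) ∧
    (∀ t : ℝ, HasDerivAt (deriv fun s => hsNorm (A s) ^ 2)
      (2 * hsNorm (deriv A t) ^ 2 +
        2 * (n : ℝ) * (Matrix.trace (deriv A t * (A t)⁻¹ * deriv A t * (A t)⁻¹) /
          Matrix.trace ((A t)⁻¹ * ((A t)⁻¹)ᵀ))) t) := by
  obtain ⟨hd, hdd, hdet, hgeo⟩ := hA
  have hA' (t : ℝ) : HasDerivAt A (deriv A t) t := (hd t).hasDerivAt
  have hA'' (t : ℝ) : HasDerivAt (deriv A) (deriv (deriv A) t) t := (hdd t).hasDerivAt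
  have h1 (t : ℝ) : HasDerivAt (fun s => hsNorm (A s) ^ 2)
      (2 * Matrix.trace (deriv A t * (A t)ᵀ)) t := by
    simp only [hsNorm_sq]
    refine ((hA' t).trace_mul_transpose (hA' t)).congr_deriv ?_
    rw [trace_mul_transpose_comm (A t) (deriv A t), two_mul]
  refine ⟨fun t => (h1 t).differentiableAt, fun t => ?_⟩
  rw [funext fun s => (h1 s).deriv]
  refine (((hA'' t).trace_mul_transpose (hA' t)).const_mul 2).congr_deriv ?_
  have hinv : ((A t)⁻¹)ᵀ * (A t)ᵀ = 1 := by
    rw [← Matrix.transpose_mul, Matrix.mul_nonsing_inv _ (by simp [hdet t]),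
      Matrix.transpose_one]
  rw [hsNorm_sq, hgeo t, Matrix.smul_mul, hinv, Matrix.trace_smul, Matrix.trace_one,
    Fintype.card_fin, smul_eq_mul]
  ring
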